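/- arXiv:2210.17333 — 2 statements merged into one kernel-verified Lean document; each statement's English description precedes it below -/
import Mathlib

section
/- Let (A,B) and (C,D) be disjoint pairs of RE subsets of ℕ. If (A,B) is doubly co-productive (DCP) and (A,B) is reducible to (C,D), then (C,D) is doubly co-productive. -/
/-- The `e`-th recursively enumerable set in the standard enumeration:
the domain of the `e`-th partial recursive function. -/
def WSet (e : ℕ) : Set ℕ :=
  {x | (Nat.Partrec.Code.eval (Denumerable.ofNat Nat.Partrec.Code e) x).Dom}

/-- A set of naturals is recursively enumerable iff it occurs in the standard enumeration. -/
def IsRE (A : Set ℕ) : Prop := ∃ e, A = WSet e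

/-- `(A,B)` is semi-reducible to `(C,D)`. -/
def SemiReducible (A B C D : Set ℕ) : Prop :=
  ∃ f : ℕ → ℕ, Computable f ∧ (∀ x, x ∈ A → f x ∈ C) ∧ (∀ x, x ∈ B → f x ∈ D)

/-- `(A,B)` is reducible to `(C,D)`. -/
def Reducible (A B C D : Set ℕ) : Prop :=
  ∃ f : ℕ → ℕ, Computable f ∧ (∀ x, x ∈ A ↔ f x ∈ C) ∧ (∀ x, x ∈ B ↔ f x ∈ D)

/-- `(C,D)` is semi-doubly universal: every disjoint pair of RE sets is semi-reducible to it. -/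
def SemiDU (C D : Set ℕ) : Prop :=
  ∀ A B : Set ℕ, IsRE A → IsRE B → A ∩ B = ∅ → SemiReducible A B C D

/-- `(C,D)` is doubly universal: every disjoint pair of RE sets is reducible to it. -/
def DU (C D : Set ℕ) : Prop :=
  ∀ A B : Set ℕ, IsRE A → IsRE B → A ∩ B = ∅ → Reducible A B C D

/-- A binary relation on ℕ is RE (via a recursive pairing). -/
def IsRERel2 (M : ℕ → ℕ → Prop) : Prop :=
  ∃ e, ∀ x y, M x y ↔ Nat.pair x y ∈ WSet e

/-- `(A,B)` has a separation function. -/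
def HasSepFun (A B : Set ℕ) : Prop :=
  ∃ S : ℕ → ℕ → ℕ → ℕ, Computable (fun p : ℕ × ℕ × ℕ => S p.1 p.2.1 p.2.2) ∧
    ∀ M₁ M₂ : ℕ → ℕ → Prop, IsRERel2 M₁ → IsRERel2 M₂ →
      ∃ h : ℕ, ∀ x y : ℕ,
        (M₁ x y ∧ ¬ M₂ x y → S h x y ∈ A) ∧
        (M₂ x y ∧ ¬ M₁ x y → S h x y ∈ B)

/-- `(A,B)` is effectively inseparable. -/
def EI (A B : Set ℕ) : Prop :=
  ∃ f : ℕ → ℕ → ℕ, Computable₂ f ∧ ∀ i j, A ⊆ WSet i → B ⊆ WSet j →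
    WSet i ∩ WSet j = ∅ → f i j ∉ WSet i ∪ WSet j

/-- `(A,B)` is completely effectively inseparable. -/
def CEI (A B : Set ℕ) : Prop :=
  ∃ f : ℕ → ℕ → ℕ, Computable₂ f ∧ ∀ i j, A ⊆ WSet i → B ⊆ WSet j →
    (f i j ∈ WSet i ↔ f i j ∈ WSet j)

/-- `(A,B)` is doubly generative. -/
def DG (A B : Set ℕ) : Prop :=
  ∃ f : ℕ → ℕ → ℕ, Computable₂ f ∧ ∀ i j, WSet i ∩ WSet j = ∅ →
    ((f i j ∈ A ↔ f i j ∈ WSet i) ∧ (f i j ∈ B ↔ f i j ∈ WSet j))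

/-- `(A,B)` is semi-doubly generative. -/
def SemiDG (A B : Set ℕ) : Prop :=
  ∃ f : ℕ → ℕ → ℕ, Computable₂ f ∧ ∀ i j, WSet i ∩ WSet j = ∅ →
    ((f i j ∈ WSet i → f i j ∈ A) ∧ (f i j ∈ WSet j → f i j ∈ B))

/-- `(A,B)` is doubly co-productive. -/
def DCP (A B : Set ℕ) : Prop :=
  ∃ f : ℕ → ℕ → ℕ, Computable₂ f ∧ ∀ i j, WSet i ∩ WSet j = ∅ →
    WSet i ∩ A = ∅ → WSet j ∩ B = ∅ → f i j ∉ A ∪ B ∪ WSet i ∪ WSet j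

/-- `(A,B)` is weakly effectively inseparable. -/
def WEI (A B : Set ℕ) : Prop :=
  ∃ f : ℕ → ℕ → ℕ, Computable₂ f ∧ ∀ i j,
    (WSet i = A → WSet j = B → f i j ∉ A ∪ B) ∧
    (WSet i = A → WSet j = B ∪ {f i j} → f i j ∈ A) ∧
    (WSet i = A ∪ {f i j} → WSet j = B → f i j ∈ B)

/-- `(A,B)` is weakly doubly co-productive. -/
def WDCP (A B : Set ℕ) : Prop :=
  ∃ f : ℕ → ℕ → ℕ, Computable₂ f ∧ ∀ i j,
    (WSet i = ∅ → WSet j = ∅ → f i j ∉ A ∪ B) ∧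
    (WSet i = ∅ → WSet j = {f i j} → f i j ∈ B) ∧
    (WSet i = {f i j} → WSet j = ∅ → f i j ∈ A)

open Nat.Partrec in
theorem exists_preimage_index (g : ℕ → ℕ) (hg : Computable g) :
    ∃ t : ℕ → ℕ, Computable t ∧ ∀ i x, x ∈ WSet (t i) ↔ g x ∈ WSet i := by
  obtain ⟨c, hc⟩ := Code.exists_code.1 (Partrec.nat_iff.1 hg.partrec)
  refine ⟨fun i => Encodable.encode (Code.comp (Denumerable.ofNat Code i) c), ?_, ?_⟩
  · exact Computable.encode.comp (Code.primrec₂_comp.to_comp.comp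
      (Computable.ofNat Code) (Computable.const c))
  · intro i x
    simp only [WSet, Set.mem_setOf_eq, Denumerable.ofNat_encode, Code.eval, hc]
    exact iff_of_eq (congrArg Part.Dom (Part.bind_some (g x) (Denumerable.ofNat Code i).eval))

theorem DCP_of_reducible (A B C D : Set ℕ) (hA : IsRE A) (hB : IsRE B) (hC : IsRE C) (hD : IsRE D)
    (hAB : A ∩ B = ∅) (hCD : C ∩ D = ∅)
    (h1 : DCP A B) (h2 : Reducible A B C D) : DCP C D := by
  obtain ⟨f, hf, hfp⟩ := h1
  obtain ⟨g, hg, hgA, hgB⟩ := h2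
  obtain ⟨t, ht, htp⟩ := exists_preimage_index g hg
  refine ⟨fun i j => g (f (t i) (t j)), ?_, ?_⟩
  · exact hg.comp (hf.comp (ht.comp Computable.fst) (ht.comp Computable.snd))
  · intro i j hij hi hj
    have key := hfp (t i) (t j) ?_ ?_ ?_
    · simpa only [Set.mem_union, htp, hgA, hgB] using key
    · ext x
      have := Set.ext_iff.1 hij (g x)
      simpa only [Set.mem_inter_iff, Set.mem_empty_iff_false, htp] using this
    · ext x
      have := Set.ext_iff.1 hi (g x)
      simpa only [Set.mem_inter_iff, Set.mem_empty_iff_false, htp, hgA] using this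
    · ext x
      have := Set.ext_iff.1 hj (g x)
      simpa only [Set.mem_inter_iff, Set.mem_empty_iff_false, htp, hgB] using this
end

section
/- If a disjoint pair (C,D) of RE subsets of ℕ is weakly effectively inseparable (WEI), then (C,D) is doubly universal (DU). -/
theorem re_or_aux {α : Type*} [Primcodable α] {p q : α → Prop} (hp : REPred p) (hq : REPred q) :
    REPred fun a => p a ∨ q a := by
  obtain ⟨k, hk, H⟩ := Partrec.merge' hp hq
  refine hk.dom_re.of_eq fun a => ?_
  rw [(H a).2]
  simp [Part.assert]

theorem re_and_aux {α : Type*} [Primcodable α] {p q : α → Prop} (hp : REPred p) (hq : REPred q) :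
    REPred fun a => p a ∧ q a := by
  have h2 : Partrec₂ fun (a : α) (_ : Unit) => Part.assert (q a) fun _ => Part.some () :=
    Partrec.comp hq Computable.fst
  refine (Partrec.bind hp h2).dom_re.of_eq fun a => ?_
  simp [Part.bind, Part.assert]

theorem re_comp_aux {α β : Type*} [Primcodable α] [Primcodable β] {p : β → Prop} {f : α → β}
    (hp : REPred p) (hf : Computable f) : REPred fun a => p (f a) :=
  Partrec.comp hp hf

theorem re_mem_aux {A : Set ℕ} (h : IsRE A) : REPred fun x => x ∈ A := by
  obtain ⟨e, rfl⟩ := h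
  have : Partrec fun x => Nat.Partrec.Code.eval (Denumerable.ofNat Nat.Partrec.Code e) x :=
    Nat.Partrec.Code.eval_part.comp (Computable.const _) Computable.id
  exact this.dom_re

theorem re_eq_aux {α : Type*} [Primcodable α] {f g : α → ℕ}
    (hf : Computable f) (hg : Computable g) : REPred fun a => f a = g a := by
  have h : ComputablePred fun p : ℕ × ℕ => p.1 = p.2 := by
    refine ⟨inferInstance, ?_⟩
    exact (PrimrecRel.decide Primrec.eq).to_comp
  exact re_comp_aux h.to_re (hf.pair hg)

/-- The fixed point: indices of `C ∪ {h x | x ∈ B}` and `D ∪ {h x | x ∈ A}`. -/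
theorem exists_indices_aux {A B C D : Set ℕ} (hA : IsRE A) (hB : IsRE B) (hC : IsRE C)
    (hD : IsRE D) {g : ℕ → ℕ → ℕ} (hg : Computable₂ g) :
    ∃ i j : ℕ → ℕ, Computable i ∧ Computable j ∧
      (∀ x y, y ∈ WSet (i x) ↔ y ∈ C ∨ (x ∈ B ∧ y = g (i x) (j x))) ∧
      (∀ x y, y ∈ WSet (j x) ↔ y ∈ D ∨ (x ∈ A ∧ y = g (i x) (j x))) := by
  let I : ℕ → Nat.Partrec.Code → ℕ → ℕ := fun b c x => Encodable.encode (c.curry (Nat.pair b x))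
  have hI : ∀ b, Computable₂ (I b) := fun b =>
    Computable.encode.comp (Nat.Partrec.Code.primrec₂_curry.to_comp.comp Computable.fst
      (Primrec₂.natPair.to_comp.comp (Computable.const b) Computable.snd))
  -- arguments: code and `pair (pair b x) y`
  let bb : Nat.Partrec.Code × ℕ → ℕ := fun p => p.2.unpair.1.unpair.1
  let xx : Nat.Partrec.Code × ℕ → ℕ := fun p => p.2.unpair.1.unpair.2
  let yy : Nat.Partrec.Code × ℕ → ℕ := fun p => p.2.unpair.2
  have hu : Computable fun p : Nat.Partrec.Code × ℕ => p.2.unpair :=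
    Computable.unpair.comp Computable.snd
  have hu1 : Computable fun p : Nat.Partrec.Code × ℕ => p.2.unpair.1.unpair :=
    Computable.unpair.comp (Computable.fst.comp hu)
  have hb : Computable bb := Computable.fst.comp hu1
  have hx : Computable xx := Computable.snd.comp hu1
  have hy : Computable yy := Computable.snd.comp hu
  let G : Nat.Partrec.Code × ℕ → ℕ := fun p => g (I 0 p.1 (xx p)) (I 1 p.1 (xx p))
  have hG : Computable G := hg.comp ((hI 0).comp Computable.fst hx) ((hI 1).comp Computable.fst hx)
  have key : REPred fun p : Nat.Partrec.Code × ℕ =>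
      (bb p = 0 ∧ (yy p ∈ C ∨ (xx p ∈ B ∧ yy p = G p))) ∨
      (bb p = 1 ∧ (yy p ∈ D ∨ (xx p ∈ A ∧ yy p = G p))) :=
    re_or_aux
      (re_and_aux (re_eq_aux hb (Computable.const 0))
        (re_or_aux (re_comp_aux (re_mem_aux hC) hy)
          (re_and_aux (re_comp_aux (re_mem_aux hB) hx) (re_eq_aux hy hG))))
      (re_and_aux (re_eq_aux hb (Computable.const 1))
        (re_or_aux (re_comp_aux (re_mem_aux hD) hy)
          (re_and_aux (re_comp_aux (re_mem_aux hA) hx) (re_eq_aux hy hG))))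
  have key2 := Partrec.map key (g := fun _ _ => (0 : ℕ)) (Computable.const 0).to₂
  obtain ⟨c, hc⟩ := Nat.Partrec.Code.fixed_point₂ (Partrec.to₂ key2)
  have hW : ∀ b x y, y ∈ WSet (I b c x) ↔
      (b = 0 ∧ (y ∈ C ∨ (x ∈ B ∧ y = g (I 0 c x) (I 1 c x)))) ∨
      (b = 1 ∧ (y ∈ D ∨ (x ∈ A ∧ y = g (I 0 c x) (I 1 c x)))) := by
    intro b x y
    have : y ∈ WSet (I b c x) ↔ (Nat.Partrec.Code.eval c (Nat.pair (Nat.pair b x) y)).Dom := by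
      simp [WSet, I, Nat.Partrec.Code.eval_curry]
    rw [this, hc]
    simp [Part.assert, bb, xx, yy, G]
  refine ⟨I 0 c, I 1 c, (hI 0).comp (Computable.const c) Computable.id,
    (hI 1).comp (Computable.const c) Computable.id, fun x y => ?_, fun x y => ?_⟩
  · rw [hW]; simp
  · rw [hW]; simp

theorem DU_of_WEI (C D : Set ℕ) (hC : IsRE C) (hD : IsRE D) (hCD : C ∩ D = ∅)
    (h : WEI C D) : DU C D := by
  obtain ⟨g, hg, H⟩ := h
  intro A B hA hB hAB
  obtain ⟨i, j, hi, hj, Hi, Hj⟩ := exists_indices_aux hA hB hC hD hg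
  have dAB : ∀ x, x ∈ A → x ∉ B := fun x h1 h2 => by
    have : x ∈ A ∩ B := ⟨h1, h2⟩
    simp [hAB] at this
  have dCD : ∀ x, x ∈ C → x ∉ D := fun x h1 h2 => by
    have : x ∈ C ∩ D := ⟨h1, h2⟩
    simp [hCD] at this
  have eC : ∀ x, x ∉ B → WSet (i x) = C := fun x hx => by ext y; rw [Hi]; simp [hx]
  have eD : ∀ x, x ∉ A → WSet (j x) = D := fun x hx => by ext y; rw [Hj]; simp [hx]
  have eC' : ∀ x, x ∈ B → WSet (i x) = C ∪ {g (i x) (j x)} := fun x hx => by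
    ext y; rw [Hi]; simp [hx, or_comm]
  have eD' : ∀ x, x ∈ A → WSet (j x) = D ∪ {g (i x) (j x)} := fun x hx => by
    ext y; rw [Hj]; simp [hx, or_comm]
  have mA : ∀ x, x ∈ A → g (i x) (j x) ∈ C := fun x hx =>
    (H (i x) (j x)).2.1 (eC x (dAB x hx)) (eD' x hx)
  have mB : ∀ x, x ∈ B → g (i x) (j x) ∈ D := fun x hx =>
    (H (i x) (j x)).2.2 (eC' x hx) (eD x fun h1 => dAB x h1 hx)
  have mN : ∀ x, x ∉ A → x ∉ B → g (i x) (j x) ∉ C ∪ D := fun x h1 h2 =>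
    (H (i x) (j x)).1 (eC x h2) (eD x h1)
  refine ⟨fun x => g (i x) (j x), hg.comp hi hj, fun x => ⟨mA x, fun h1 => ?_⟩,
    fun x => ⟨mB x, fun h1 => ?_⟩⟩
  · by_contra hx
    by_cases hxB : x ∈ B
    · exact dCD _ h1 (mB x hxB)
    · exact mN x hx hxB (Or.inl h1)
  · by_contra hx
    by_cases hxA : x ∈ A
    · exact dCD _ (mA x hxA) h1
    · exact mN x hxA hx (Or.inr h1)
end
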